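/- arXiv:1510.00648 — 7 statements merged into one kernel-verified Lean document; each statement's English description precedes it below -/
import Mathlib

section
/- The function sending a real number r to the set O_r = {I ∈ T : r ∈ I} is a bijection from the real numbers onto the set of o-ideals of the ternary pseudotree T. -/
/-- The node `I(k,n) = (k/2^n, (k+2)/2^n)` of the ternary pseudotree. -/
def dyadicNode (k n : ℤ) : Set ℝ :=
  Set.Ioo ((k : ℝ) / 2 ^ n) (((k : ℝ) + 2) / 2 ^ n)

/-- The ternary pseudotree `T`, viewed as the collection of its nodes. -/
def pseudotree : Set (Set ℝ) := {I | ∃ k n : ℤ, I = dyadicNode k n}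

/-- An o-ideal: a nonempty set of nodes, closed downwards and under join, in which
every node has a nonextreme descendant. -/
def IsOIdeal (O : Set (Set ℝ)) : Prop :=
  O.Nonempty ∧ O ⊆ pseudotree ∧
  (∀ I ∈ O, ∀ J ∈ pseudotree, I ⊆ J → J ∈ O) ∧
  (∀ I ∈ O, ∀ J ∈ O, I ∩ J ∈ pseudotree ∧ I ∩ J ∈ O) ∧
  (∀ I ∈ O, ∃ J ∈ O, closure J ⊆ I)

theorem mem_node (k n : ℤ) (x : ℝ) :
    x ∈ dyadicNode k n ↔ (k : ℝ) < x * 2 ^ n ∧ x * 2 ^ n < k + 2 := by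
  have h : (0 : ℝ) < 2 ^ n := by positivity
  simp only [dyadicNode, Set.mem_Ioo, div_lt_iff₀ h, lt_div_iff₀ h]

theorem node_lt (k n : ℤ) : (k : ℝ) / 2 ^ n < ((k : ℝ) + 2) / 2 ^ n := by
  have h : (0 : ℝ) < 2 ^ n := by positivity
  gcongr
  linarith

theorem closure_node (k n : ℤ) :
    closure (dyadicNode k n) = Set.Icc ((k : ℝ) / 2 ^ n) (((k : ℝ) + 2) / 2 ^ n) :=
  closure_Ioo (node_lt k n).ne

theorem node_nonempty (k n : ℤ) : (dyadicNode k n).Nonempty :=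
  Set.nonempty_Ioo.2 (node_lt k n)

theorem inter_node_aux (k n l m : ℤ) (hnm : n ≤ m) (x : ℝ) (hx : x ∈ dyadicNode k n)
    (hx' : x ∈ dyadicNode l m) : dyadicNode k n ∩ dyadicNode l m ∈ pseudotree := by
  obtain ⟨d, rfl⟩ := Int.le.dest hnm
  obtain ⟨D, hD⟩ : ∃ D : ℤ, D = 2 ^ d := ⟨_, rfl⟩
  have hD1 : 1 ≤ D := by rw [hD]; exact one_le_pow₀ (by norm_num)
  have hDR : (2 : ℝ) ^ d = D := by rw [hD]; push_cast; rfl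
  have hDp : (0 : ℝ) < D := by exact_mod_cast hD1
  have key : ∀ y : ℝ, y ∈ dyadicNode k n ↔ ((k * D : ℤ) : ℝ) < y * 2 ^ (n + d : ℤ) ∧
      y * 2 ^ (n + d : ℤ) < ((k * D + 2 * D : ℤ) : ℝ) := by
    intro y
    rw [mem_node, zpow_add₀ (by norm_num), zpow_natCast, hDR, ← mul_assoc]
    push_cast
    rw [← add_mul, mul_lt_mul_iff_left₀ hDp, mul_lt_mul_iff_left₀ hDp]
  have hs : ∀ (y : ℝ) (j : ℤ), y ∈ dyadicNode (2 * j) (n + d + 1) ↔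
      (j : ℝ) < y * 2 ^ (n + d : ℤ) ∧ y * 2 ^ (n + d : ℤ) < j + 1 := by
    intro y j
    rw [mem_node, zpow_add₀ (by norm_num) (n + d : ℤ) 1, zpow_one]
    push_cast
    constructor <;> rintro ⟨h1, h2⟩ <;> constructor <;> linarith
  rw [key] at hx
  rw [mem_node] at hx'
  have i1 : k * D < l + 2 := by
    have := hx.1.trans hx'.2
    exact_mod_cast this
  have i2 : l < k * D + 2 * D := by
    have := hx'.1.trans hx.2
    exact_mod_cast this
  generalize hK : k * D = K at *
  rcases lt_or_ge l K with h | h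
  · obtain rfl : K = l + 1 := by omega
    refine ⟨2 * (l + 1), n + d + 1, ?_⟩
    ext y
    rw [Set.mem_inter_iff, key, hs, mem_node]
    have : (1 : ℝ) ≤ D := by exact_mod_cast hD1
    push_cast
    constructor
    · rintro ⟨⟨h1, h2⟩, h3, h4⟩; constructor <;> linarith
    · rintro ⟨h1, h2⟩; refine ⟨⟨?_, ?_⟩, ?_, ?_⟩ <;> linarith
  · have hR : (K : ℝ) ≤ l := by exact_mod_cast h
    rcases lt_or_ge (K + 2 * D) (l + 2) with h' | h'
    · have e : K + 2 * D = l + 1 := by omega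
      refine ⟨2 * l, n + d + 1, ?_⟩
      ext y
      rw [Set.mem_inter_iff, key, hs, mem_node, e]
      push_cast
      constructor
      · rintro ⟨⟨h1, h2⟩, h3, h4⟩; constructor <;> linarith
      · rintro ⟨h1, h2⟩; refine ⟨⟨?_, ?_⟩, ?_, ?_⟩ <;> linarith
    · refine ⟨l, n + d, ?_⟩
      ext y
      have hR' : (l : ℝ) + 2 ≤ ((K + 2 * D : ℤ) : ℝ) := by exact_mod_cast h'
      rw [Set.mem_inter_iff, key, mem_node]
      constructor
      · rintro ⟨⟨h1, h2⟩, h3, h4⟩; constructor <;> linarith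
      · rintro ⟨h1, h2⟩; refine ⟨⟨?_, ?_⟩, ?_, ?_⟩ <;> linarith

theorem inter_node {I J : Set ℝ} (hI : I ∈ pseudotree) (hJ : J ∈ pseudotree) (x : ℝ)
    (hx : x ∈ I) (hx' : x ∈ J) : I ∩ J ∈ pseudotree := by
  obtain ⟨k, n, rfl⟩ := hI
  obtain ⟨l, m, rfl⟩ := hJ
  rcases le_total n m with h | h
  · exact inter_node_aux k n l m h x hx hx'
  · rw [Set.inter_comm]
    exact inter_node_aux l m k n h x hx' hx

theorem small_node (ε : ℝ) (hε : 0 < ε) : ∃ N : ℕ, ∀ k n : ℤ, (N : ℤ) ≤ n → ∀ r : ℝ,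
    r ∈ closure (dyadicNode k n) → closure (dyadicNode k n) ⊆ Metric.ball r ε := by
  obtain ⟨N, hN⟩ := pow_unbounded_of_one_lt (2 / ε) (one_lt_two : (1 : ℝ) < 2)
  refine ⟨N, fun k n hn r hr y hy => ?_⟩
  rw [closure_node, Set.mem_Icc] at hr hy
  have h : (0 : ℝ) < 2 ^ n := by positivity
  have h1 : (2 : ℝ) ^ N ≤ 2 ^ n := by
    rw [← zpow_natCast]
    exact zpow_le_zpow_right₀ (by norm_num) hn
  have h2 : 2 / (2 : ℝ) ^ n < ε := by
    rw [div_lt_iff₀ hε] at hN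
    rw [div_lt_iff₀ h]
    nlinarith
  rw [add_div] at hr hy
  rw [Metric.mem_ball, Real.dist_eq, abs_lt]
  constructor <;> linarith

theorem exists_node (r : ℝ) (n : ℤ) : ∃ k : ℤ, r ∈ dyadicNode k n := by
  refine ⟨⌊r * 2 ^ n⌋ - 1, ?_⟩
  rw [mem_node]
  have h1 := Int.floor_le (r * 2 ^ n)
  have h2 := Int.lt_floor_add_one (r * 2 ^ n)
  push_cast
  constructor <;> linarith

theorem exists_small (r ε : ℝ) (hε : 0 < ε) :
    ∃ J ∈ pseudotree, r ∈ J ∧ closure J ⊆ Metric.ball r ε := by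
  obtain ⟨N, hN⟩ := small_node ε hε
  obtain ⟨k, hk⟩ := exists_node r N
  exact ⟨_, ⟨k, N, rfl⟩, hk, hN k N le_rfl r (subset_closure hk)⟩

theorem isOpen_of_mem {I : Set ℝ} (hI : I ∈ pseudotree) : IsOpen I := by
  obtain ⟨k, n, rfl⟩ := hI
  exact isOpen_Ioo

theorem level_lt (k n l m : ℤ) (h : closure (dyadicNode l m) ⊆ dyadicNode k n) : n < m := by
  rw [closure_node] at h
  have a := h (Set.left_mem_Icc.2 (node_lt l m).le)
  have b := h (Set.right_mem_Icc.2 (node_lt l m).le)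
  simp only [dyadicNode, Set.mem_Ioo, add_div] at a b
  have hm : (0 : ℝ) < 2 ^ m := by positivity
  have hn : (0 : ℝ) < 2 ^ n := by positivity
  have h2 : (2 : ℝ) / 2 ^ m < 2 / 2 ^ n := by linarith
  have h3 : (2 : ℝ) ^ n < 2 ^ m := (div_lt_div_iff_of_pos_left two_pos hm hn).1 h2
  exact (zpow_lt_zpow_iff_right₀ (by norm_num)).1 h3

/-- The map `r ↦ O_r = {I ∈ T : r ∈ I}` is a bijection from the
real numbers onto the set of o-ideals of the ternary pseudotree. -/
theorem O_r_bijection :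
    Set.BijOn (fun r : ℝ => {I | I ∈ pseudotree ∧ r ∈ I})
      Set.univ {O | IsOIdeal O} := by
  refine ⟨?_, ?_, ?_⟩
  · intro r _
    refine ⟨?_, fun I hI => hI.1, fun I hI J hJ hIJ => ⟨hJ, hIJ hI.2⟩, ?_, ?_⟩
    · obtain ⟨k, hk⟩ := exists_node r 0
      exact ⟨_, ⟨k, 0, rfl⟩, hk⟩
    · intro I hI J hJ
      have := inter_node hI.1 hJ.1 r hI.2 hJ.2
      exact ⟨this, this, hI.2, hJ.2⟩
    · intro I hI
      obtain ⟨ε, hε, hb⟩ := Metric.isOpen_iff.1 (isOpen_of_mem hI.1) r hI.2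
      obtain ⟨J, hJ, hr, hJb⟩ := exists_small r ε hε
      exact ⟨J, ⟨hJ, hr⟩, hJb.trans hb⟩
  · intro r _ s _ hrs
    by_contra hne
    obtain ⟨J, hJ, hr, hJb⟩ := exists_small r (dist s r) (dist_pos.2 (Ne.symm hne))
    have h : J ∈ {I | I ∈ pseudotree ∧ s ∈ I} := by
      have h0 : J ∈ {I | I ∈ pseudotree ∧ r ∈ I} := ⟨hJ, hr⟩
      have hrs' : {I | I ∈ pseudotree ∧ r ∈ I} = {I | I ∈ pseudotree ∧ s ∈ I} := hrs
      rwa [hrs'] at h0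
    exact lt_irrefl _ (Metric.mem_ball.1 (hJb (subset_closure h.2)))
  · rintro O ⟨hne, hT, hdown, hjoin, hdesc⟩
    have hlev : ∃ n₀ : ℤ, ∀ d : ℕ, ∃ k n : ℤ, n₀ + d ≤ n ∧ dyadicNode k n ∈ O := by
      obtain ⟨I, hI⟩ := hne
      obtain ⟨k, n, rfl⟩ := hT hI
      refine ⟨n, fun d => ?_⟩
      induction d with
      | zero => exact ⟨k, n, by simp, hI⟩
      | succ d ih =>
        obtain ⟨k', n', h1, h2⟩ := ih
        obtain ⟨J, hJ, hc⟩ := hdesc _ h2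
        obtain ⟨l, m, rfl⟩ := hT hJ
        have := level_lt _ _ _ _ hc
        exact ⟨l, m, by push_cast; omega, hJ⟩
    have hcap : (⋂ i : O, closure (i : Set ℝ)).Nonempty := by
      have : Nonempty O := hne.to_subtype
      apply IsCompact.nonempty_iInter_of_directed_nonempty_isCompact_isClosed
      · intro i j
        refine ⟨⟨_, (hjoin i i.2 j j.2).2⟩, ?_, ?_⟩
        · exact closure_mono Set.inter_subset_left
        · exact closure_mono Set.inter_subset_right
      · intro i
        obtain ⟨k, n, h⟩ := hT i.2
        rw [h]
        exact (node_nonempty k n).closure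
      · intro i
        obtain ⟨k, n, h⟩ := hT i.2
        rw [h, closure_node]
        exact isCompact_Icc
      · intro i
        exact isClosed_closure
    obtain ⟨r, hr⟩ := hcap
    have hr' : ∀ I ∈ O, r ∈ closure I := fun I hI => Set.mem_iInter.1 hr ⟨I, hI⟩
    refine ⟨r, Set.mem_univ _, ?_⟩
    ext J
    constructor
    · rintro ⟨hJ, hrJ⟩
      obtain ⟨ε, hε, hb⟩ := Metric.isOpen_iff.1 (isOpen_of_mem hJ) r hrJ
      obtain ⟨N, hN⟩ := small_node ε hε
      obtain ⟨n₀, hn₀⟩ := hlev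
      obtain ⟨k, n, h1, h2⟩ := hn₀ (N + n₀.natAbs)
      have hn : (N : ℤ) ≤ n := by omega
      exact hdown _ h2 J hJ ((subset_closure.trans (hN k n hn r (hr' _ h2))).trans hb)
    · intro hJ
      obtain ⟨K, hK, hc⟩ := hdesc J hJ
      exact ⟨hT hJ, hc (hr' K hK)⟩
end

section
/- The function sending a real number r to the set C_r = {I ∈ T : r belongs to the closure of I} is a bijection from the real numbers onto the set of c-ideals of the ternary pseudotree T. -/
/-- A c-ideal: a nonempty downward-closed set of nodes (identified with their
parameters `(k, n)`) satisfying the six closure conditions.  The children of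
`(k, n)` are `λI = (2k, n+1)`, `μI = (2k+1, n+1)` and `ρI = (2k+2, n+1)`;
`ρ^i (k, n) = ((k+2)·2^i - 2, n+i)` and `λ^i (k, n) = (k·2^i, n+i)`. -/
def IsCIdeal (C : Set (ℤ × ℤ)) : Prop :=
  C.Nonempty ∧
  -- downward closed
  (∀ k n j m : ℤ, (k, n) ∈ C → dyadicNode k n ⊆ dyadicNode j m → (j, m) ∈ C) ∧
  -- (1) every node in C has a child in C
  (∀ k n : ℤ, (k, n) ∈ C →
    ((2 * k, n + 1) ∈ C ∨ (2 * k + 1, n + 1) ∈ C ∨ (2 * k + 2, n + 1) ∈ C)) ∧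
  -- (2) the nodes of C at each level form an adjacent block of at most three nodes
  (∀ k j n : ℤ, (k, n) ∈ C → (j, n) ∈ C →
    |k - j| ≤ 2 ∧ ∀ i : ℤ, k ≤ i → i ≤ j → (i, n) ∈ C) ∧
  -- (3) double negation elimination for membership
  (∀ k n : ℤ, ¬ ((k, n) ∉ C) → (k, n) ∈ C) ∧
  -- (4) if the left child is missing the right child is present, and conversely
  (∀ k n : ℤ, (k, n) ∈ C →
    ((2 * k, n + 1) ∉ C → (2 * k + 2, n + 1) ∈ C) ∧
    ((2 * k + 2, n + 1) ∉ C → (2 * k, n + 1) ∈ C)) ∧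
  -- (5) all right (resp. left) iterated extreme descendants lie in C iff the node is
  -- the leftmost (resp. rightmost) of three adjacent nodes of C at its level
  (∀ k n : ℤ, (k, n) ∈ C →
    ((∀ i : ℕ, ((k + 2) * 2 ^ i - 2, n + (i : ℤ)) ∈ C) ↔
      ((k + 1, n) ∈ C ∧ (k + 2, n) ∈ C)) ∧
    ((∀ i : ℕ, (k * 2 ^ i, n + (i : ℤ)) ∈ C) ↔
      ((k - 1, n) ∈ C ∧ (k - 2, n) ∈ C))) ∧
  -- (6) closure under joins, whenever the join exists in T
  (∀ k n j m k' n' : ℤ, (k, n) ∈ C → (j, m) ∈ C →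
    dyadicNode k' n' = dyadicNode k n ∩ dyadicNode j m → (k', n') ∈ C)

lemma mem_closure_node (r : ℝ) (k n : ℤ) :
    r ∈ closure (dyadicNode k n) ↔ (k : ℝ) ≤ r * 2 ^ n ∧ r * 2 ^ n ≤ k + 2 := by
  have h2 : (0 : ℝ) < 2 ^ n := by positivity
  have hne : (k : ℝ) / 2 ^ n < ((k : ℝ) + 2) / 2 ^ n := by gcongr; linarith
  rw [dyadicNode, closure_Ioo hne.ne, Set.mem_Icc, div_le_iff₀ h2, le_div_iff₀ h2]

lemma scale_succ (r : ℝ) (n : ℤ) : r * 2 ^ (n + 1) = 2 * (r * 2 ^ n) := by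
  rw [zpow_add_one₀ (by norm_num)]; ring

lemma scale_add (r : ℝ) (n : ℤ) (i : ℕ) : r * 2 ^ (n + (i : ℤ)) = (r * 2 ^ n) * 2 ^ i := by
  rw [zpow_add₀ (by norm_num), zpow_natCast]; ring

lemma nonpos_of_mul_pow_le {a b : ℝ} (h : ∀ i : ℕ, a * 2 ^ i ≤ b) : a ≤ 0 := by
  by_contra! ha
  obtain ⟨i, hi⟩ := pow_unbounded_of_one_lt (b / a) (one_lt_two : (1 : ℝ) < 2)
  rw [div_lt_iff₀ ha] at hi
  have := h i
  linarith

lemma node_subset_parent {k j n : ℤ} (h1 : 2 * j ≤ k) (h2 : k ≤ 2 * j + 2) :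
    dyadicNode k (n + 1) ⊆ dyadicNode j n := by
  have h0 : (0 : ℝ) < 2 ^ n := by positivity
  have h1' : (2 : ℝ) * j ≤ k := by exact_mod_cast h1
  have h2' : (k : ℝ) ≤ 2 * j + 2 := by exact_mod_cast h2
  unfold dyadicNode
  rw [zpow_add_one₀ (by norm_num)]
  apply Set.Ioo_subset_Ioo
  · rw [div_le_div_iff₀ h0 (by positivity)]; nlinarith
  · rw [div_le_div_iff₀ (by positivity) h0]; nlinarith

lemma node_inter_closure {r : ℝ} {k n j m k' n' : ℤ}
    (h1 : r ∈ closure (dyadicNode k n)) (h2 : r ∈ closure (dyadicNode j m))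
    (h : dyadicNode k' n' = dyadicNode k n ∩ dyadicNode j m) :
    r ∈ closure (dyadicNode k' n') := by
  have hk : ∀ k n : ℤ, (k : ℝ) / 2 ^ n < ((k : ℝ) + 2) / 2 ^ n := by
    intro k n; gcongr; linarith
  have hne : (dyadicNode k' n').Nonempty := Set.nonempty_Ioo.2 (hk _ _)
  rw [h] at hne ⊢
  unfold dyadicNode at *
  rw [Set.Ioo_inter_Ioo] at hne ⊢
  rw [closure_Ioo (hk _ _).ne] at h1 h2
  rw [closure_Ioo (Set.nonempty_Ioo.1 hne).ne, ← Set.Icc_inter_Icc]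
  exact ⟨h1, h2⟩

lemma isCIdeal_Cr (r : ℝ) : IsCIdeal {p : ℤ × ℤ | r ∈ closure (dyadicNode p.1 p.2)} := by
  refine ⟨⟨(⌊r⌋, 0), ?_⟩, ?_, ?_, ?_, ?_, ?_, ?_, ?_⟩
  · simp only [Set.mem_setOf_eq, mem_closure_node]
    have := Int.floor_le r
    have := Int.lt_floor_add_one r
    constructor <;> simp <;> linarith
  · intro k n j m h hs
    exact closure_mono hs h
  · intro k n h
    simp only [Set.mem_setOf_eq, mem_closure_node, scale_succ] at h ⊢
    push_cast
    rcases le_total (r * 2 ^ n) (k + 1) with h' | h'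
    · left; constructor <;> linarith
    · right; right; constructor <;> linarith
  · intro k j n h1 h2
    simp only [Set.mem_setOf_eq, mem_closure_node] at h1 h2 ⊢
    constructor
    · have : |(k : ℝ) - j| ≤ 2 := by rw [abs_le]; constructor <;> linarith
      exact_mod_cast this
    · intro i hi hj
      have hi' : (k : ℝ) ≤ i := by exact_mod_cast hi
      have hj' : (i : ℝ) ≤ j := by exact_mod_cast hj
      constructor <;> linarith
  · intro k n h; exact not_not.1 h
  · intro k n h
    simp only [Set.mem_setOf_eq, mem_closure_node, scale_succ] at h ⊢
    push_cast
    rcases le_total (r * 2 ^ n) (k + 1) with h' | h'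
    · exact ⟨fun hn => absurd ⟨by linarith, by linarith⟩ hn,
        fun _ => ⟨by linarith, by linarith⟩⟩
    · exact ⟨fun _ => ⟨by linarith, by linarith⟩,
        fun hn => absurd ⟨by linarith, by linarith⟩ hn⟩
  · intro k n h
    simp only [Set.mem_setOf_eq, mem_closure_node, scale_add] at h ⊢
    push_cast
    generalize r * 2 ^ n = x at h
    refine ⟨⟨fun H => ?_, fun H i => ?_⟩, ⟨fun H => ?_, fun H i => ?_⟩⟩
    · have := nonpos_of_mul_pow_le (a := k + 2 - x) (b := 2) fun i => by
        have := (H i).1; linarith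
      refine ⟨⟨?_, ?_⟩, ?_, ?_⟩ <;> linarith
    · have : x = k + 2 := by linarith [H.2.1, h.2]
      subst this; constructor <;> linarith
    · have := nonpos_of_mul_pow_le (a := x - k) (b := 2) fun i => by
        have := (H i).2; linarith
      refine ⟨⟨?_, ?_⟩, ?_, ?_⟩ <;> linarith
    · have : x = k := by linarith [H.2.2, h.1]
      subst this; constructor <;> linarith
  · intro k n j m k' n' h1 h2 h
    exact node_inter_closure h1 h2 h

lemma le_of_Cr_subset {r s : ℝ}
    (h : ∀ p : ℤ × ℤ, r ∈ closure (dyadicNode p.1 p.2) → s ∈ closure (dyadicNode p.1 p.2)) :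
    s ≤ r := by
  have := nonpos_of_mul_pow_le (a := s - r) (b := 2) fun i => by
    have := h (⌊r * 2 ^ i⌋, (i : ℤ))
    simp only [mem_closure_node, zpow_natCast] at this
    have h1 := Int.floor_le (r * 2 ^ i)
    have h2 := Int.lt_floor_add_one (r * 2 ^ i)
    have := (this ⟨h1, by linarith⟩).2
    linarith
  linarith

lemma descend {C : Set (ℤ × ℤ)} (hC : IsCIdeal C) {k n : ℤ} (h : (k, n) ∈ C) (d : ℕ) :
    ∃ k', (k', n + (d : ℤ)) ∈ C ∧ k * 2 ^ d ≤ k' ∧ k' + 2 ≤ (k + 2) * 2 ^ d := by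
  obtain ⟨_, _, h1, _⟩ := hC
  induction d with
  | zero => exact ⟨k, by simpa using h, by simp, by simp⟩
  | succ d ih =>
    obtain ⟨k', hk, ha, hb⟩ := ih
    have e : n + ((d + 1 : ℕ) : ℤ) = n + d + 1 := by push_cast; ring
    rw [e, pow_succ]
    rcases h1 _ _ hk with h | h | h
    · exact ⟨_, h, by linarith, by linarith⟩
    · exact ⟨_, h, by linarith, by linarith⟩
    · exact ⟨_, h, by linarith, by linarith⟩

lemma level_nonempty {C : Set (ℤ × ℤ)} (hC : IsCIdeal C) (n : ℤ) : ∃ k, (k, n) ∈ C := by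
  obtain ⟨⟨⟨k₀, n₀⟩, h0⟩, hd, h1, _⟩ := hC
  induction n using Int.inductionOn' (b := n₀) with
  | zero => exact ⟨k₀, h0⟩
  | succ n _ ih =>
    obtain ⟨k, hk⟩ := ih
    rcases h1 _ _ hk with h | h | h <;> exact ⟨_, h⟩
  | pred n _ ih =>
    obtain ⟨k, hk⟩ := ih
    refine ⟨k / 2, hd _ _ _ _ hk ?_⟩
    have := node_subset_parent (k := k) (j := k / 2) (n := n - 1) (by omega) (by omega)
    simpa using this

lemma left_le_right {C : Set (ℤ × ℤ)} (hC : IsCIdeal C) {k n j m : ℤ}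
    (h1 : (k, n) ∈ C) (h2 : (j, m) ∈ C) : (k : ℝ) / 2 ^ n ≤ ((j : ℝ) + 2) / 2 ^ m := by
  obtain ⟨d, e, hde⟩ : ∃ d e : ℕ, n + (d : ℤ) = m + (e : ℤ) :=
    ⟨(max n m - n).toNat, (max n m - m).toNat, by omega⟩
  obtain ⟨k', hk, hk1, -⟩ := descend hC h1 d
  obtain ⟨j', hj, -, hj2⟩ := descend hC h2 e
  rw [hde] at hk
  have h3 := (hC.2.2.2.1 _ _ _ hk hj).1
  rw [abs_le] at h3
  have h4 : k * 2 ^ d ≤ (j + 2) * 2 ^ e := by linarith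
  have h5 : (k : ℝ) * 2 ^ d ≤ (j + 2) * 2 ^ e := by exact_mod_cast h4
  have e1 : (k : ℝ) / 2 ^ n = k * 2 ^ d / 2 ^ (n + (d : ℤ)) := by
    rw [zpow_add₀ (by norm_num), zpow_natCast]; field_simp
  have e2 : ((j : ℝ) + 2) / 2 ^ m = (j + 2) * 2 ^ e / 2 ^ (m + (e : ℤ)) := by
    rw [zpow_add₀ (by norm_num), zpow_natCast]; field_simp
  rw [e1, e2, hde]
  gcongr

lemma exists_common {C : Set (ℤ × ℤ)} (hC : IsCIdeal C) :
    ∃ r : ℝ, ∀ k n : ℤ, (k, n) ∈ C → (k : ℝ) ≤ r * 2 ^ n ∧ r * 2 ^ n ≤ k + 2 := by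
  let S : Set ℝ := {x | ∃ k n : ℤ, (k, n) ∈ C ∧ x = (k : ℝ) / 2 ^ n}
  obtain ⟨⟨k₀, n₀⟩, h0⟩ := hC.1
  have hub : ∀ j m : ℤ, (j, m) ∈ C → ((j : ℝ) + 2) / 2 ^ m ∈ upperBounds S := by
    rintro j m hj x ⟨k, n, hk, rfl⟩
    exact left_le_right hC hk hj
  refine ⟨sSup S, fun k n h => ⟨?_, ?_⟩⟩
  · rw [← div_le_iff₀ (by positivity)]
    exact le_csSup ⟨_, hub _ _ h0⟩ ⟨k, n, h, rfl⟩
  · rw [← le_div_iff₀ (by positivity)]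
    exact csSup_le ⟨_, k₀, n₀, h0, rfl⟩ (hub _ _ h)

lemma surj_aux {C : Set (ℤ × ℤ)} (hC : IsCIdeal C) :
    ∃ r : ℝ, ∀ k n : ℤ, (k, n) ∈ C ↔ (k : ℝ) ≤ r * 2 ^ n ∧ r * 2 ^ n ≤ k + 2 := by
  obtain ⟨r, hr⟩ := exists_common hC
  have hlev := level_nonempty hC
  obtain ⟨_, hd, h1, h2, _, h4, h5, _⟩ := hC
  have par : ∀ {k n : ℤ} (j : ℤ), (k, n + 1) ∈ C → 2 * j ≤ k → k ≤ 2 * j + 2 → (j, n) ∈ C :=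
    fun j h a b => hd _ _ _ _ h (node_subset_parent a b)
  -- if `r` is the right endpoint of a node in `C`
  have hright : ∀ x n : ℤ, r * 2 ^ n = x → (x - 2, n) ∈ C → (x - 1, n) ∈ C ∧ (x, n) ∈ C := by
    intro x n hx h
    have := (h5 _ _ h).1.1 ?_
    · have e1 : x - 2 + 1 = x - 1 := by ring
      have e2 : x - 2 + 2 = x := by ring
      rwa [e1, e2] at this
    intro i
    rw [sub_add_cancel]
    induction i with
    | zero => simpa using h
    | succ i ih =>
      have e : n + ((i + 1 : ℕ) : ℤ) = n + i + 1 := by push_cast; ring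
      have e3 : x * 2 ^ (i + 1) - 2 = 2 * (x * 2 ^ i - 2) + 2 := by ring
      rw [e, e3]
      refine (h4 _ _ ih).1 fun hn => ?_
      have := (hr _ _ hn).2
      rw [scale_succ, scale_add, hx] at this
      push_cast at this
      linarith
  have hleft : ∀ x n : ℤ, r * 2 ^ n = x → (x, n) ∈ C → (x - 1, n) ∈ C ∧ (x - 2, n) ∈ C := by
    intro x n hx h
    refine (h5 _ _ h).2.1 ?_
    intro i
    induction i with
    | zero => simpa using h
    | succ i ih =>
      have e : n + ((i + 1 : ℕ) : ℤ) = n + i + 1 := by push_cast; ring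
      have e3 : x * 2 ^ (i + 1) = 2 * (x * 2 ^ i) := by ring
      rw [e, e3]
      refine (h4 _ _ ih).2 fun hn => ?_
      have := (hr _ _ hn).1
      rw [scale_succ, scale_add, hx] at this
      push_cast at this
      linarith
  have hint : ∀ x n : ℤ, r * 2 ^ n = x → (x, n) ∈ C ∧ (x - 1, n) ∈ C ∧ (x - 2, n) ∈ C := by
    intro x n hx
    obtain ⟨j, hj⟩ := hlev n
    obtain ⟨ha, hb⟩ := hr _ _ hj
    rw [hx] at ha hb
    have ha : j ≤ x := by exact_mod_cast ha
    have hb : x ≤ j + 2 := by exact_mod_cast hb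
    obtain rfl | rfl | rfl : j = x ∨ j = x - 1 ∨ j = x - 2 := by omega
    · exact ⟨hj, hleft _ _ hx hj⟩
    · have hx' : r * 2 ^ (n + 1) = ((2 * x : ℤ) : ℝ) := by rw [scale_succ, hx]; push_cast; ring
      have hboth : (2 * x, n + 1) ∈ C ∧ (2 * x - 2, n + 1) ∈ C := by
        have e1 : 2 * (x - 1) = 2 * x - 2 := by ring
        have e2 : 2 * (x - 1) + 2 = 2 * x := by ring
        have h4' := (h4 _ _ hj).1
        rw [e2, e1] at h4'
        by_cases hc : (2 * x - 2, n + 1) ∈ C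
        · exact ⟨(hright _ _ hx' hc).2, hc⟩
        · have := h4' hc
          exact ⟨this, (hleft _ _ hx' this).2⟩
      exact ⟨par _ hboth.1 (by omega) (by omega), hj, par _ hboth.2 (by omega) (by omega)⟩
    · have := hright _ _ hx hj
      exact ⟨this.2, this.1, hj⟩
  refine ⟨r, fun k n => ⟨hr k n, ?_⟩⟩
  rintro ⟨hk1, hk2⟩
  by_cases hx : ∃ x : ℤ, r * 2 ^ n = x
  · obtain ⟨x, hx⟩ := hx
    obtain ⟨ha, hb, hc⟩ := hint x n hx
    rw [hx] at hk1 hk2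
    have hk1 : k ≤ x := by exact_mod_cast hk1
    have hk2 : x ≤ k + 2 := by exact_mod_cast hk2
    obtain rfl | rfl | rfl : k = x ∨ k = x - 1 ∨ k = x - 2 := by omega
    all_goals assumption
  · obtain ⟨f, hf⟩ : ∃ f, f = ⌊r * 2 ^ n⌋ := ⟨_, rfl⟩
    have f1 : (f : ℝ) < r * 2 ^ n :=
      lt_of_le_of_ne (hf ▸ Int.floor_le _) fun h => hx ⟨f, h.symm⟩
    have f2 : r * 2 ^ n < f + 1 := hf ▸ Int.lt_floor_add_one _
    have key : ∀ j : ℤ, (j : ℝ) ≤ r * 2 ^ n → r * 2 ^ n ≤ j + 2 → j = f ∨ j = f - 1 := by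
      intro j a b
      have a' : (j : ℝ) < f + 1 := by linarith
      have b' : (f : ℝ) < j + 2 := by linarith
      have a' : j < f + 1 := by exact_mod_cast a'
      have b' : f < j + 2 := by exact_mod_cast b'
      omega
    have hmid : (2 * f, n + 1) ∈ C := by
      obtain ⟨j, hj⟩ := hlev n
      obtain ⟨ha, hb⟩ := hr _ _ hj
      rcases key j ha hb with rfl | rfl
      · refine (h4 _ _ hj).2 fun hn => ?_
        have := (hr _ _ hn).1
        rw [scale_succ] at this
        push_cast at this
        linarith
      · have e2 : 2 * f = 2 * (f - 1) + 2 := by ring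
        rw [e2]
        refine (h4 _ _ hj).1 fun hn => ?_
        have := (hr _ _ hn).2
        rw [scale_succ] at this
        push_cast at this
        linarith
    rcases key k hk1 hk2 with rfl | rfl <;> exact par _ hmid (by omega) (by omega)

/-- The map `r ↦ C_r = {I ∈ T : r ∈ closure I}` is a bijection from
the real numbers onto the set of c-ideals of the ternary pseudotree. -/
theorem C_r_bijection :
    Set.BijOn (fun r : ℝ => {p : ℤ × ℤ | r ∈ closure (dyadicNode p.1 p.2)})
      Set.univ {C | IsCIdeal C} := by
  refine ⟨fun r _ => isCIdeal_Cr r, fun r _ s _ h => ?_, fun C hC => ?_⟩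
  · have h' := fun p => Set.ext_iff.1 h p
    exact le_antisymm (le_of_Cr_subset fun p => (h' p).2) (le_of_Cr_subset fun p => (h' p).1)
  · obtain ⟨r, hr⟩ := surj_aux hC
    refine ⟨r, Set.mem_univ _, ?_⟩
    ext ⟨k, n⟩
    simp only [Set.mem_setOf_eq, mem_closure_node]
    exact (hr k n).symm
end

section
/- If S is a Cauchy subset of the ternary pseudotree T that converges to the real number r, then O_r ⊆ S. Consequently, O_r is the intersection of all Cauchy subsets of T converging to r. -/
/-- A Cauchy subset of `T`: downward closed, containing nodes of arbitrarily high
level, whose deep nodes have left endpoints arbitrarily close together. -/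
def IsCauchySubset (S : Set (ℤ × ℤ)) : Prop :=
  (∀ k n j m : ℤ, (k, n) ∈ S → dyadicNode k n ⊆ dyadicNode j m → (j, m) ∈ S) ∧
  (∀ l : ℤ, ∃ k n : ℤ, (k, n) ∈ S ∧ l < n) ∧
  (∀ p : ℕ, ∃ l : ℤ, ∀ j s k t : ℤ, (j, s) ∈ S → (k, t) ∈ S → l < s → l < t →
    |(j : ℝ) / 2 ^ s - (k : ℝ) / 2 ^ t| < 2 ^ (-(p : ℤ)))

/-- A subset of `T` converges to `r` if nodes of sufficiently high level have
midpoint arbitrarily close to `r`. -/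
def ConvergesTo (S : Set (ℤ × ℤ)) (r : ℝ) : Prop :=
  ∀ ε : ℝ, 0 < ε → ∃ l : ℤ, ∀ k n : ℤ, (k, n) ∈ S → l < n →
    |((k : ℝ) + 1) / 2 ^ n - r| < ε

lemma exists_level_lt (ε : ℝ) (hε : 0 < ε) : ∃ L : ℤ, ∀ n : ℤ, L < n → ((2 : ℝ) ^ n)⁻¹ < ε := by
  obtain ⟨N, hN⟩ := exists_pow_lt_of_lt_one hε (by norm_num : (2⁻¹ : ℝ) < 1)
  refine ⟨N, fun n hn => lt_of_le_of_lt ?_ hN⟩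
  rw [inv_pow]
  apply inv_anti₀ (by positivity)
  rw [← zpow_natCast]
  exact zpow_le_zpow_right₀ (by norm_num) hn.le

lemma O_r_isCauchy (r : ℝ) : IsCauchySubset {p : ℤ × ℤ | r ∈ dyadicNode p.1 p.2} := by
  refine ⟨fun k n j m h hs => hs h, fun l => ⟨⌈r * 2 ^ (l + 1)⌉ - 1, l + 1, ?_, by omega⟩, ?_⟩
  · have hp : (0 : ℝ) < 2 ^ (l + 1) := by positivity
    have h1 := Int.le_ceil (r * 2 ^ (l + 1))
    have h2 := Int.ceil_lt_add_one (r * 2 ^ (l + 1))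
    simp only [dyadicNode, Set.mem_setOf_eq, Set.mem_Ioo]
    rw [div_lt_iff₀ hp, lt_div_iff₀ hp]
    push_cast
    constructor <;> linarith
  · intro p
    obtain ⟨l, hl⟩ := exists_level_lt (2 ^ (-(p : ℤ)) / 2) (by positivity)
    refine ⟨l, fun j s k t hj hk hs ht => ?_⟩
    have h1 := hl s hs
    have h2 := hl t ht
    simp only [dyadicNode, Set.mem_setOf_eq, Set.mem_Ioo, div_eq_mul_inv, add_mul] at hj hk h1 h2 ⊢
    rw [abs_lt]
    constructor <;> linarith [hj.1, hj.2, hk.1, hk.2]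

lemma O_r_converges (r : ℝ) : ConvergesTo {p : ℤ × ℤ | r ∈ dyadicNode p.1 p.2} r := by
  intro ε hε
  obtain ⟨l, hl⟩ := exists_level_lt ε hε
  refine ⟨l, fun k n hk hn => ?_⟩
  have h1 := hl n hn
  simp only [dyadicNode, Set.mem_setOf_eq, Set.mem_Ioo, div_eq_mul_inv, add_mul] at hk h1 ⊢
  rw [abs_lt]
  constructor <;> linarith [hk.1, hk.2]

lemma O_r_subset (r : ℝ) (S : Set (ℤ × ℤ)) (hS : IsCauchySubset S) (hc : ConvergesTo S r) :
    {p : ℤ × ℤ | r ∈ dyadicNode p.1 p.2} ⊆ S := by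
  rintro ⟨k, n⟩ ⟨ha, hb⟩
  simp only at ha hb
  obtain ⟨ε, hε, h1, h2⟩ : ∃ ε : ℝ, 0 < ε ∧ 2 * ε ≤ r - (k : ℝ) / 2 ^ n ∧
      2 * ε ≤ ((k : ℝ) + 2) / 2 ^ n - r := by
    refine ⟨min (r - (k : ℝ) / 2 ^ n) (((k : ℝ) + 2) / 2 ^ n - r) / 2, ?_, ?_, ?_⟩
    · have := lt_min (sub_pos.2 ha) (sub_pos.2 hb)
      linarith
    · linarith [min_le_left (r - (k : ℝ) / 2 ^ n) (((k : ℝ) + 2) / 2 ^ n - r)]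
    · linarith [min_le_right (r - (k : ℝ) / 2 ^ n) (((k : ℝ) + 2) / 2 ^ n - r)]
  obtain ⟨l, hl⟩ := hc ε hε
  obtain ⟨L, hL⟩ := exists_level_lt ε hε
  obtain ⟨j, m, hj, hm⟩ := hS.2.1 (max l L)
  have h3 := abs_lt.1 (hl j m hj (lt_of_le_of_lt (le_max_left _ _) hm))
  have h4 := hL m (lt_of_le_of_lt (le_max_right _ _) hm)
  refine hS.1 j m k n hj (Set.Ioo_subset_Ioo ?_ ?_)
  · rw [div_eq_mul_inv (j : ℝ)]
    rw [div_eq_mul_inv _ ((2 : ℝ) ^ m), add_mul] at h3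
    linarith [h3.1, h3.2]
  · rw [div_eq_mul_inv _ ((2 : ℝ) ^ m), add_mul]
    rw [div_eq_mul_inv _ ((2 : ℝ) ^ m), add_mul] at h3
    linarith [h3.1, h3.2]

/-- Every Cauchy subset of `T` converging to `r` contains
`O_r = {(k,n) : r ∈ I(k,n)}`; consequently `O_r` is the intersection of all Cauchy
subsets of `T` converging to `r`. -/
theorem O_r_subset_cauchySubsets (r : ℝ) :
    (∀ S : Set (ℤ × ℤ), IsCauchySubset S → ConvergesTo S r →
      {p : ℤ × ℤ | r ∈ dyadicNode p.1 p.2} ⊆ S) ∧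
    {p : ℤ × ℤ | r ∈ dyadicNode p.1 p.2} =
      ⋂₀ {S : Set (ℤ × ℤ) | IsCauchySubset S ∧ ConvergesTo S r} := by
  refine ⟨O_r_subset r, Set.Subset.antisymm ?_ ?_⟩
  · exact Set.subset_sInter fun S hS => O_r_subset r S hS.1 hS.2
  · exact Set.sInter_subset_of_mem ⟨O_r_isCauchy r, O_r_converges r⟩
end

section
/- Let (c_n) be a sequence of rational numbers converging to the real number r, and for each natural number n let J_n = (k_n/2^n, (k_n+2)/2^n) be the node of level n where k_n is the greatest integer with k_n/2^n ≤ c_n. Then the downward closure of {J_n : n ∈ ℕ} in the ternary pseudotree T is a Cauchy subset of T converging to r. -/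
theorem key_bound (c : ℕ → ℚ) (r : ℝ)
    (hc : Filter.Tendsto (fun n : ℕ => (c n : ℝ)) Filter.atTop (nhds r)) (ε : ℝ) (hε : 0 < ε) :
    ∃ l : ℤ, ∀ k n : ℤ, (∃ m : ℕ, dyadicNode ⌊c m * 2 ^ m⌋ (m : ℤ) ⊆ dyadicNode k n) → l < n →
      |(k : ℝ) / 2 ^ n - r| < ε ∧ |((k : ℝ) + 1) / 2 ^ n - r| < ε := by
  obtain ⟨N, hN⟩ := Metric.tendsto_atTop.1 hc (ε / 4) (by positivity)
  obtain ⟨M, hM⟩ := exists_pow_lt_of_lt_one (show 0 < ε / 4 by positivity)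
    (show (1 / 2 : ℝ) < 1 by norm_num)
  refine ⟨max N M, ?_⟩
  rintro k n ⟨m, hm⟩ hl
  have hNn : (N : ℤ) < n := lt_of_le_of_lt (le_max_left _ _) hl
  have hMn : (M : ℤ) < n := lt_of_le_of_lt (le_max_right _ _) hl
  have hpm : (0 : ℝ) < 2 ^ (m : ℤ) := by positivity
  have hpn : (0 : ℝ) < 2 ^ n := by positivity
  unfold dyadicNode at hm
  rw [Set.Ioo_subset_Ioo_iff (by gcongr; linarith)] at hm
  obtain ⟨h1, h2⟩ := hm
  rw [add_div, add_div] at h2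
  have hmn : n ≤ (m : ℤ) := by
    have h3 : (2 : ℝ) / 2 ^ (m : ℤ) ≤ 2 / 2 ^ n := by linarith
    have h4 : (2 : ℝ) ^ n ≤ 2 ^ (m : ℤ) := by
      rwa [div_le_div_iff_of_pos_left (by norm_num) hpm hpn] at h3
    exact (zpow_le_zpow_iff_right₀ (by norm_num)).1 h4
  have hcm := hN m (by omega)
  rw [Real.dist_eq, abs_lt] at hcm
  have f1 : ((⌊c m * 2 ^ m⌋ : ℤ) : ℝ) / 2 ^ (m : ℤ) ≤ c m := by
    rw [div_le_iff₀ hpm, zpow_natCast]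
    exact_mod_cast Int.floor_le (c m * 2 ^ m)
  have f2 : (c m : ℝ) ≤ ((⌊c m * 2 ^ m⌋ : ℤ) : ℝ) / 2 ^ (m : ℤ) + 2 / 2 ^ (m : ℤ) := by
    rw [← add_div, le_div_iff₀ hpm, zpow_natCast]
    have := (Int.lt_floor_add_one (c m * 2 ^ m)).le
    have h5 : (c m : ℝ) * 2 ^ m ≤ (⌊c m * 2 ^ m⌋ : ℤ) + 1 := by exact_mod_cast this
    linarith
  have hs : (1 : ℝ) / 2 ^ n < ε / 4 := by
    refine lt_of_le_of_lt ?_ hM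
    rw [one_div_pow, ← zpow_natCast]
    gcongr
    norm_num
  have hs0 : (0 : ℝ) < 1 / 2 ^ n := by positivity
  have h22 : (2 : ℝ) / 2 ^ n = 2 * (1 / 2 ^ n) := by ring
  rw [h22] at h2
  rw [add_div, abs_lt, abs_lt]
  refine ⟨⟨?_, ?_⟩, ?_, ?_⟩ <;> linarith [hcm.1, hcm.2]

/-- Given a sequence of rationals `c` converging to `r`, let
`J_n = I(⌊c_n · 2^n⌋, n)` be the level-`n` node whose left endpoint `k/2^n` is
largest with `k/2^n ≤ c_n`.  Then the downward closure of `{J_n : n ∈ ℕ}` in `T`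
is a Cauchy subset of `T` converging to `r`. -/
theorem downset_of_cauchySeq_isCauchySubset (c : ℕ → ℚ) (r : ℝ)
    (hc : Filter.Tendsto (fun n : ℕ => (c n : ℝ)) Filter.atTop (nhds r)) :
    IsCauchySubset {p : ℤ × ℤ | ∃ n : ℕ,
        dyadicNode ⌊c n * 2 ^ n⌋ (n : ℤ) ⊆ dyadicNode p.1 p.2} ∧
    ConvergesTo {p : ℤ × ℤ | ∃ n : ℕ,
        dyadicNode ⌊c n * 2 ^ n⌋ (n : ℤ) ⊆ dyadicNode p.1 p.2} r := by
  refine ⟨⟨?_, ?_, ?_⟩, ?_⟩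
  · rintro k n j m ⟨a, ha⟩ h
    exact ⟨a, ha.trans h⟩
  · intro l
    exact ⟨_, ((l.toNat + 1 : ℕ) : ℤ), ⟨l.toNat + 1, subset_rfl⟩, by omega⟩
  · intro p
    obtain ⟨l, hl⟩ := key_bound c r hc ((2 : ℝ) ^ (-(p : ℤ)) / 2) (by positivity)
    refine ⟨l, fun j s k t hj hk hs ht => ?_⟩
    have h1 := abs_lt.1 (hl j s hj hs).1
    have h2 := abs_lt.1 (hl k t hk ht).1
    rw [abs_lt]
    constructor <;> linarith [h1.1, h1.2, h2.1, h2.2]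
  · intro ε hε
    obtain ⟨l, hl⟩ := key_bound c r hc ε hε
    exact ⟨l, fun k n hk hn => (hl k n hk hn).2⟩
end

section
/- Let V and W be Riesz spaces over ℝ, suppose W has a unit e and is archimedean with respect to e, and let f : V → W be a Riesz homomorphism over ℚ (an additive, ℚ-homogeneous map preserving binary suprema). Then f is a homomorphism over ℝ: f(r•x) = r•f(x) for every real number r and every x ∈ V. -/
/-- Let `V`, `W` be Riesz spaces over `ℝ` (lattice-ordered real
vector spaces), let `e` be a unit of `W`, and suppose `W` is archimedean with respect
to `e` (here `|w| = (w ⊔ 0) + (-w ⊔ 0)`).  Then every Riesz homomorphism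
`f : V → W` over `ℚ` (additive, `ℚ`-homogeneous and preserving binary suprema)
is a homomorphism over `ℝ`: `f (r • x) = r • f x`. -/
theorem riesz_hom_over_Q_is_over_R {V W : Type*}
    [AddCommGroup V] [Lattice V] [Module ℝ V]
    [AddCommGroup W] [Lattice W] [Module ℝ W]
    -- `V` is a Riesz space: translation invariance and positivity of scalar action
    (hVadd : ∀ x y z : V, x ≤ y → x + z ≤ y + z)
    (hVsmul : ∀ (c : ℝ) (x : V), 0 ≤ c → 0 ≤ x → 0 ≤ c • x)
    -- `W` is a Riesz space
    (hWadd : ∀ x y z : W, x ≤ y → x + z ≤ y + z)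
    (hWsmul : ∀ (c : ℝ) (x : W), 0 ≤ c → 0 ≤ x → 0 ≤ c • x)
    -- `e` is a unit of `W`
    (e : W) (hunit : ∀ w : W, ∃ n : ℕ, w ≤ (n : ℝ) • e)
    -- `W` is archimedean with respect to `e`
    (harch : ∀ w : W, (∀ q : ℚ, 0 < q → (w ⊔ 0) + (-w ⊔ 0) ≤ (q : ℝ) • e) → w = 0)
    -- `f` is a Riesz homomorphism over `ℚ`
    (f : V → W)
    (hadd : ∀ x y : V, f (x + y) = f x + f y)
    (hqsmul : ∀ (q : ℚ) (x : V), f ((q : ℝ) • x) = (q : ℝ) • f x)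
    (hsup : ∀ x y : V, f (x ⊔ y) = f x ⊔ f y)
    (r : ℝ) (x : V) : f (r • x) = r • f x := by
  haveI : IsOrderedAddMonoid V :=
    { add_le_add_left := fun a b h c => hVadd a b c h }
  haveI : IsOrderedAddMonoid W :=
    { add_le_add_left := fun a b h c => hWadd a b c h }
  have hmono : ∀ a b : V, a ≤ b → f a ≤ f b := by
    intro a b h
    have h1 := hsup a b
    rw [sup_eq_right.2 h] at h1
    rw [h1]
    exact le_sup_left
  have hVs : ∀ (a b : ℝ) (y : V), 0 ≤ y → a ≤ b → a • y ≤ b • y := by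
    intro a b y hy h
    have h1 := hVsmul (b - a) y (sub_nonneg.2 h) hy
    rw [sub_smul] at h1
    exact sub_nonneg.1 h1
  have hWs : ∀ (a b : ℝ) (y : W), 0 ≤ y → a ≤ b → a • y ≤ b • y := by
    intro a b y hy h
    have h1 := hWsmul (b - a) y (sub_nonneg.2 h) hy
    rw [sub_smul] at h1
    exact sub_nonneg.1 h1
  have hWl : ∀ (c : ℝ) (y z : W), 0 ≤ c → y ≤ z → c • y ≤ c • z := by
    intro c y z hc h
    have h1 := hWsmul c (z - y) hc (sub_nonneg.2 h)
    rw [smul_sub] at h1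
    exact sub_nonneg.1 h1
  have he : 0 ≤ e := by
    obtain ⟨n, hn⟩ := hunit (-e)
    have h1 : 0 ≤ ((n : ℝ) + 1) • e := by
      rw [add_smul, one_smul]
      exact neg_le_iff_add_nonneg.1 hn
    have hp : (0 : ℝ) < (n : ℝ) + 1 := by positivity
    have h2 := hWsmul ((n : ℝ) + 1)⁻¹ _ (by positivity) h1
    rwa [smul_smul, inv_mul_cancel₀ hp.ne', one_smul] at h2
  have hf0 : f 0 = 0 := by
    have h1 := hadd 0 0
    rw [add_zero] at h1
    exact left_eq_add.1 h1
  have hpos : ∀ y : V, 0 ≤ y → f (r • y) = r • f y := by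
    intro y hy
    have hfy : 0 ≤ f y := hf0 ▸ hmono 0 y hy
    obtain ⟨n, hn⟩ := hunit (f y)
    refine sub_eq_zero.1 (harch _ ?_)
    intro q hq
    have hq' : (0 : ℝ) < q := by exact_mod_cast hq
    obtain ⟨d, hd, hdq⟩ : ∃ d : ℝ, 0 < d ∧ d * n + d * n ≤ q := by
      refine ⟨q / (2 * (n + 1)), by positivity, ?_⟩
      have : (q : ℝ) / (2 * (n + 1)) * n + q / (2 * (n + 1)) * n = q * (n / (n + 1)) := by
        field_simp
        ring
      rw [this]
      have h3 : (n : ℝ) / (n + 1) ≤ 1 := by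
        rw [div_le_one (by positivity)]
        linarith
      nlinarith
    obtain ⟨q1, h1, h1'⟩ := exists_rat_btwn (show r - d < r by linarith)
    obtain ⟨q2, h2, h2'⟩ := exists_rat_btwn (show r < r + d by linarith)
    have hdn : d • f y ≤ (d * n) • e := by
      rw [mul_smul]
      exact hWl d _ _ hd.le hn
    have hA : f (r • y) - r • f y ≤ (d * n) • e := by
      refine le_trans ?_ hdn
      rw [sub_le_iff_le_add, ← add_smul]
      have h4 := hmono _ _ (hVs r q2 y hy h2.le)
      rw [hqsmul] at h4
      exact h4.trans (hWs _ _ _ hfy (by linarith))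
    have hB : -(f (r • y) - r • f y) ≤ (d * n) • e := by
      refine le_trans ?_ hdn
      have h4 := hmono _ _ (hVs q1 r y hy h1'.le)
      rw [hqsmul] at h4
      rw [neg_sub, sub_le_comm, ← sub_smul]
      exact (hWs _ _ _ hfy (by linarith)).trans h4
    have h0 : 0 ≤ (d * n) • e := hWsmul _ _ (by positivity) he
    refine (add_le_add (sup_le hA h0) (sup_le hB h0)).trans ?_
    rw [← add_smul]
    exact hWs _ _ _ he hdq
  have h1 := hpos (x ⊔ 0) le_sup_right
  have h2 := hpos (x ⊔ 0 - x) (sub_nonneg.2 le_sup_left)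
  have h3 := hadd (r • x) (r • (x ⊔ 0 - x))
  have h4 := hadd x (x ⊔ 0 - x)
  rw [← smul_add, add_sub_cancel, h1, h2] at h3
  rw [add_sub_cancel] at h4
  rw [h4, smul_add] at h3
  exact (add_right_cancel h3).symm
end

section
/- Let V = ℝ × ℝ with the lexicographic order ((x₁,y₁) ≤ (x₂,y₂) iff x₁ < x₂, or x₁ = x₂ and y₁ ≤ y₂) and componentwise vector space structure, and let g : ℝ → ℝ be an additive, ℚ-homogeneous map. Define f : V → V by f(x,y) = (x, g(x) + y). Then f is additive, ℚ-homogeneous, and order-preserving (and hence preserves binary suprema and infima in the lexicographic order); moreover, f satisfies f(r•v) = r•f(v) for all r ∈ ℝ and v ∈ V if and only if g is ℝ-linear, i.e., g(r·x) = r·g(x) for all r, x ∈ ℝ. -/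
/-- The lexicographic order on `ℝ × ℝ`. -/
def lexLe (p q : ℝ × ℝ) : Prop := p.1 < q.1 ∨ (p.1 = q.1 ∧ p.2 ≤ q.2)

/-- The map `f(x, y) = (x, g(x) + y)` on `ℝ × ℝ`. -/
def lexMap (g : ℝ → ℝ) : ℝ × ℝ → ℝ × ℝ := fun p => (p.1, g p.1 + p.2)

/-- For `V = ℝ × ℝ` with the lexicographic order and an additive,
`ℚ`-homogeneous `g : ℝ → ℝ`, the map `f(x,y) = (x, g(x) + y)` is additive,
`ℚ`-homogeneous and order-preserving, and it is `ℝ`-homogeneous iff `g` is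
`ℝ`-linear. -/
theorem lexMap_riesz_hom (g : ℝ → ℝ)
    (hgadd : ∀ x y : ℝ, g (x + y) = g x + g y)
    (hgq : ∀ (q : ℚ) (x : ℝ), g ((q : ℝ) * x) = (q : ℝ) * g x) :
    (∀ v w : ℝ × ℝ, lexMap g (v + w) = lexMap g v + lexMap g w) ∧
    (∀ (q : ℚ) (v : ℝ × ℝ), lexMap g ((q : ℝ) • v) = (q : ℝ) • lexMap g v) ∧
    (∀ v w : ℝ × ℝ, lexLe v w → lexLe (lexMap g v) (lexMap g w)) ∧
    ((∀ (r : ℝ) (v : ℝ × ℝ), lexMap g (r • v) = r • lexMap g v) ↔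
      ∀ r x : ℝ, g (r * x) = r * g x) := by
  refine ⟨?_, ?_, ?_, ?_, ?_⟩
  · rintro ⟨a, b⟩ ⟨c, d⟩
    ext
    · simp [lexMap]
    · simp [lexMap, hgadd]
      ring
  · rintro q ⟨a, b⟩
    ext
    · simp [lexMap]
    · simp [lexMap, hgq]
      ring
  · rintro ⟨a, b⟩ ⟨c, d⟩ h
    rcases h with h | ⟨h, h'⟩
    · exact Or.inl h
    · refine Or.inr ⟨h, ?_⟩
      simp only [lexMap] at *
      rw [h]
      linarith
  · intro h r x
    have := congrArg Prod.snd (h r (x, 0))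
    simpa [lexMap] using this
  · rintro h r ⟨a, b⟩
    ext
    · simp [lexMap]
    · simp [lexMap, h]
      ring
end

section
/- Let V be a Riesz space over ℚ with unit 1, and let f : V → ℝ be a Riesz homomorphism over ℚ with f(1) = 1. If a ∈ V and f(a) > 0, then Pos(a) holds: there exists a rational number q > 0 such that q ≤ r for every r ∈ U(a). -/
/-- Let `V` be a Riesz space over `ℚ` with unit `u`, and let
`f : V → ℝ` be a Riesz homomorphism over `ℚ` with `f u = 1`.  If `f a > 0`, then
`Pos(a)` holds: there is a rational `q > 0` below every element of
`U(a) = {s ∈ ℚ : a < s}`, where `a < s` means `a ≤ q' • u` for some rational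
`q' < s`. -/
theorem pos_of_riesz_hom_pos {V : Type*}
    [AddCommGroup V] [Lattice V] [Module ℚ V]
    -- `V` is a Riesz space over `ℚ`
    (hVadd : ∀ x y z : V, x ≤ y → x + z ≤ y + z)
    (hVsmul : ∀ (c : ℚ) (x : V), 0 ≤ c → 0 ≤ x → 0 ≤ c • x)
    -- `u` is a unit of `V`
    (u : V) (hunit : ∀ x : V, ∃ n : ℕ, x ≤ (n : ℚ) • u)
    -- `f` is a Riesz homomorphism over `ℚ` sending `u` to `1`
    (f : V → ℝ)
    (hadd : ∀ x y : V, f (x + y) = f x + f y)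
    (hsmul : ∀ (q : ℚ) (x : V), f (q • x) = (q : ℝ) * f x)
    (hsup : ∀ x y : V, f (x ⊔ y) = max (f x) (f y))
    (hfu : f u = 1)
    (a : V) (ha : 0 < f a) :
    ∃ q : ℚ, 0 < q ∧ ∀ s : ℚ, (∃ q' : ℚ, q' < s ∧ a ≤ q' • u) → q ≤ s := by
  obtain ⟨q, hq0, hqa⟩ := exists_rat_btwn ha
  refine ⟨q, by exact_mod_cast hq0, ?_⟩
  rintro s ⟨q', hq's, hle⟩
  have h1 : f a ≤ f (q' • u) := by
    have h2 := hsup a (q' • u)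
    rw [sup_eq_right.mpr hle] at h2
    rw [h2]
    exact le_max_left _ _
  rw [hsmul, hfu, mul_one] at h1
  have h3 : q < q' := by exact_mod_cast hqa.trans_le h1
  exact (h3.trans hq's).le
end
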